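/- Let N ≥ 1, let k_1,…,k_N > 0, and let a_j, b_j, q_j : ℝ → ℝ (j = 1,…,N) be differentiable functions solving the Popowicz N-peakon ODE system with a_j(0) = k_j^2 b_j(0)^2, b_j(0) > 0 for all j, and q_1(0) < q_2(0) < ⋯ < q_N(0). Then for all t ∈ ℝ: b_j(t) > 0 for all j, the strict ordering q_1(t) < q_2(t) < ⋯ < q_N(t) persists (no two peaks ever overlap), and the amplitudes b_j are bounded, since (b_1(t),…,b_N(t)) remains on the compact quadric 2∑_{j=1}^N (k_j^2 b_j^2 + b_j) = h with h = 2∑_{j=1}^N (k_j^2 b_j(0)^2 + b_j(0)). -/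

import Mathlib

open Finset

/-- The Popowicz `N`-peakon ODE system on all of `ℝ`: for each `j < N` and `t`,
`aⱼ' = 2aⱼ ∑_{k<N} (2aₖ+bₖ) sgn(qⱼ-qₖ) e^{-|qⱼ-qₖ|}`,
`bⱼ' = bⱼ ∑_{k<N} (2aₖ+bₖ) sgn(qⱼ-qₖ) e^{-|qⱼ-qₖ|}`,
`qⱼ' = ∑_{k<N} (2aₖ+bₖ) e^{-|qⱼ-qₖ|}`. -/
def PopowiczPeakonSystem (N : ℕ) (a b q : ℕ → ℝ → ℝ) : Prop :=
  ∀ j < N, ∀ t : ℝ,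
    HasDerivAt (a j) (2 * a j t * ∑ k ∈ Finset.range N,
      (2 * a k t + b k t) * Real.sign (q j t - q k t) * Real.exp (-|q j t - q k t|)) t ∧
    HasDerivAt (b j) (b j t * ∑ k ∈ Finset.range N,
      (2 * a k t + b k t) * Real.sign (q j t - q k t) * Real.exp (-|q j t - q k t|)) t ∧
    HasDerivAt (q j) (∑ k ∈ Finset.range N,
      (2 * a k t + b k t) * Real.exp (-|q j t - q k t|)) t

/-- If `|y'| ≤ S |y|` with `S` continuous, a zero of `y` forces `y` to vanish identically. -/
theorem eq_zero_of_abs_deriv_le_mul_abs {y y' S : ℝ → ℝ} (hS : Continuous S)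
    (hy : ∀ t, HasDerivAt y (y' t) t) (hle : ∀ t, |y' t| ≤ S t * |y t|)
    {t₀ : ℝ} (h₀ : y t₀ = 0) (t : ℝ) : y t = 0 := by
  have hI : ∀ t, HasDerivAt (fun t => ∫ s in (0 : ℝ)..t, S s) (S t) t := fun t =>
    (hS.integral_hasStrictDerivAt 0 t).hasDerivAt
  set I : ℝ → ℝ := fun t => ∫ s in (0 : ℝ)..t, S s
  have hyy : ∀ t, |y t * y' t| ≤ S t * y t ^ 2 := fun t => by
    rw [abs_mul, ← sq_abs (y t)]
    nlinarith [hle t, abs_nonneg (y t)]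
  have hd : ∀ c t, HasDerivAt (fun t => y t ^ 2 * Real.exp (c * I t))
      ((2 * (y t * y' t) + c * (S t * y t ^ 2)) * Real.exp (c * I t)) t := fun c t => by
    refine (((hy t).fun_pow 2).fun_mul (((hI t).const_mul c).exp)).congr_deriv ?_
    push_cast
    ring
  have hmono : Monotone (fun t => y t ^ 2 * Real.exp (2 * I t)) := by
    refine monotone_of_hasDerivAt_nonneg (hd 2) fun t => ?_
    have := (abs_le.1 (hyy t)).1
    exact mul_nonneg (by linarith) (Real.exp_pos _).le
  have hanti : Antitone (fun t => y t ^ 2 * Real.exp (-2 * I t)) := by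
    refine antitone_of_hasDerivAt_nonpos (hd (-2)) fun t => ?_
    have := (abs_le.1 (hyy t)).2
    exact mul_nonpos_of_nonpos_of_nonneg (by linarith) (Real.exp_pos _).le
  have key : ∀ c, y t ^ 2 * Real.exp (c * I t) ≤ y t₀ ^ 2 * Real.exp (c * I t₀) → y t = 0 := by
    intro c h
    rw [h₀] at h
    have hpos := Real.exp_pos (c * I t)
    have : y t ^ 2 ≤ 0 := by
      by_contra! hc
      have := mul_pos hc hpos
      simp at h
      linarith
    exact pow_eq_zero_iff two_ne_zero |>.1 (le_antisymm this (sq_nonneg _))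
  rcases le_total t t₀ with h | h
  · exact key 2 (hmono h)
  · exact key (-2) (hanti h)

/-- If `|y'| ≤ S |y|` with `S` continuous, `y` keeps its positive sign. -/
theorem pos_of_abs_deriv_le_mul_abs {y y' S : ℝ → ℝ} (hS : Continuous S)
    (hy : ∀ t, HasDerivAt y (y' t) t) (hle : ∀ t, |y' t| ≤ S t * |y t|)
    {t₀ : ℝ} (h₀ : 0 < y t₀) (t : ℝ) : 0 < y t := by
  by_contra! h
  have hc : Continuous y := continuous_iff_continuousAt.2 fun t => (hy t).continuousAt
  obtain ⟨s, hs⟩ := mem_range_of_exists_le_of_exists_ge hc ⟨t, h⟩ ⟨t₀, h₀.le⟩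
  exact h₀.ne' (eq_zero_of_abs_deriv_le_mul_abs hS hy hle hs t₀)

theorem abs_exp_neg_abs_sub_le (x y : ℝ) :
    |Real.exp (-|x|) - Real.exp (-|y|)| ≤ |x - y| := by
  have key : ∀ u v : ℝ, 0 ≤ v → Real.exp (-v) - Real.exp (-u) ≤ |u - v| := fun u v hv => by
    have h1 : Real.exp (-u) = Real.exp (-v) * Real.exp (v - u) := by
      rw [← Real.exp_add]; ring_nf
    have h2 := Real.add_one_le_exp (v - u)
    have h3 : Real.exp (-v) ≤ 1 := Real.exp_le_one_iff.2 (by linarith)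
    have h4 := Real.exp_pos (-v)
    rw [h1]
    nlinarith [le_abs_self (u - v), abs_nonneg (u - v)]
  refine le_trans (abs_le.2 ⟨?_, ?_⟩) (abs_abs_sub_abs_le_abs_sub x y)
  · linarith [key |x| |y| (abs_nonneg _)]
  · rw [abs_sub_comm]
    exact key |y| |x| (abs_nonneg _)

theorem abs_sign_mul_exp_neg_abs_le_one (x : ℝ) : |Real.sign x * Real.exp (-|x|)| ≤ 1 := by
  have h1 : |Real.sign x| ≤ 1 := by
    rcases Real.sign_apply_eq x with h | h | h <;> simp [h]
  have h2 : Real.exp (-|x|) ≤ 1 := Real.exp_le_one_iff.2 (by linarith [abs_nonneg x])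
  rw [abs_mul, abs_of_pos (Real.exp_pos _)]
  exact mul_le_one₀ h1 (Real.exp_pos _).le h2

theorem sum_sum_eq_zero_of_antisymm {ι : Type*} (s : Finset ι) (f : ι → ι → ℝ)
    (hf : ∀ i j, f i j = -f j i) : ∑ i ∈ s, ∑ j ∈ s, f i j = 0 := by
  have h : ∑ i ∈ s, ∑ j ∈ s, f i j = -∑ i ∈ s, ∑ j ∈ s, f i j := by
    conv_lhs => rw [Finset.sum_comm]
    simp only [← Finset.sum_neg_distrib]
    exact Finset.sum_congr rfl fun i _ => Finset.sum_congr rfl fun j _ => hf j i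
  linarith

/-- For solutions of the Popowicz `N`-peakon ODE system with initial data
`aⱼ(0) = kⱼ² bⱼ(0)²`, `bⱼ(0) > 0` and strictly ordered peaks
`q₀(0) < q₁(0) < ⋯ < q_{N-1}(0)`: the amplitudes `bⱼ` stay positive, the strict
ordering persists (no two peaks ever overlap), and the amplitudes remain bounded
since `(b₀(t), …, b_{N-1}(t))` stays on the compact quadric
`2∑_{j<N}(kⱼ²bⱼ² + bⱼ) = h` with `h = 2∑_{j<N}(kⱼ²bⱼ(0)² + bⱼ(0))`. -/
theorem popowicz_N_peakon_no_overlap (N : ℕ) (hN : 1 ≤ N)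
    (k : ℕ → ℝ) (hk : ∀ j < N, 0 < k j)
    (a b q : ℕ → ℝ → ℝ)
    (hsys : PopowiczPeakonSystem N a b q)
    (hcas : ∀ j < N, a j 0 = (k j) ^ 2 * (b j 0) ^ 2)
    (hbpos : ∀ j < N, 0 < b j 0)
    (horder : ∀ j l, j < l → l < N → q j 0 < q l 0) :
    (∀ t : ℝ, ∀ j < N, 0 < b j t) ∧
    (∀ t : ℝ, ∀ j l, j < l → l < N → q j t < q l t) ∧
    (∀ t : ℝ, 2 * ∑ j ∈ Finset.range N, ((k j) ^ 2 * (b j t) ^ 2 + b j t)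
        = 2 * ∑ j ∈ Finset.range N, ((k j) ^ 2 * (b j 0) ^ 2 + b j 0)) ∧
    (∃ M : ℝ, ∀ t : ℝ, ∀ j < N, |b j t| ≤ M) := by
  set S : ℝ → ℝ := fun t => ∑ i ∈ Finset.range N, |2 * a i t + b i t|
  set F : ℕ → ℝ → ℝ := fun j t => ∑ i ∈ Finset.range N,
    (2 * a i t + b i t) * Real.sign (q j t - q i t) * Real.exp (-|q j t - q i t|) with hF
  have ha : ∀ j < N, ∀ t, HasDerivAt (a j) (2 * a j t * F j t) t :=
    fun j hj t => (hsys j hj t).1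
  have hb : ∀ j < N, ∀ t, HasDerivAt (b j) (b j t * F j t) t :=
    fun j hj t => (hsys j hj t).2.1
  have hq := fun j hj t => (hsys j hj t).2.2
  have hS : Continuous S := by
    refine continuous_finsetSum _ fun i hi => ?_
    have hi := Finset.mem_range.1 hi
    have hac : Continuous (a i) := continuous_iff_continuousAt.2 fun t => (ha i hi t).continuousAt
    have hbc : Continuous (b i) := continuous_iff_continuousAt.2 fun t => (hb i hi t).continuousAt
    fun_prop
  have hFS : ∀ j t, |F j t| ≤ S t := fun j t => by
    refine (Finset.abs_sum_le_sum_abs _ _).trans (Finset.sum_le_sum fun i _ => ?_)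
    rw [mul_assoc, abs_mul]
    exact mul_le_of_le_one_right (abs_nonneg _) (abs_sign_mul_exp_neg_abs_le_one _)
  have hpos : ∀ t : ℝ, ∀ j < N, 0 < b j t := fun t j hj =>
    pos_of_abs_deriv_le_mul_abs hS (hb j hj) (fun t => by
      rw [abs_mul, mul_comm]
      exact mul_le_mul_of_nonneg_right (hFS j t) (abs_nonneg _)) (hbpos j hj) t
  have hcasimir : ∀ t : ℝ, ∀ j < N, a j t = k j ^ 2 * b j t ^ 2 := fun t j hj => by
    have hd : ∀ t, HasDerivAt (fun t => a j t - k j ^ 2 * b j t ^ 2)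
        (2 * (a j t - k j ^ 2 * b j t ^ 2) * F j t) t := fun t => by
      refine ((ha j hj t).fun_sub (((hb j hj t).fun_pow 2).const_mul (k j ^ 2))).congr_deriv ?_
      push_cast
      ring
    refine sub_eq_zero.1 (eq_zero_of_abs_deriv_le_mul_abs (hS.const_mul 2) hd (fun t => ?_)
      (sub_eq_zero.2 (hcas j hj)) t)
    rw [abs_mul, abs_mul, abs_two]
    nlinarith [mul_le_mul_of_nonneg_left (hFS j t) (abs_nonneg (a j t - k j ^ 2 * b j t ^ 2))]
  have hquadric : ∀ t : ℝ, 2 * ∑ j ∈ Finset.range N, ((k j) ^ 2 * (b j t) ^ 2 + b j t)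
      = 2 * ∑ j ∈ Finset.range N, ((k j) ^ 2 * (b j 0) ^ 2 + b j 0) := fun t => by
    have hd : ∀ t, HasDerivAt (fun t => ∑ j ∈ Finset.range N, (a j t + b j t)) 0 t := fun t => by
      have h0 : ∑ j ∈ Finset.range N, (2 * a j t * F j t + b j t * F j t) = 0 := by
        rw [← sum_sum_eq_zero_of_antisymm (Finset.range N) (fun j i =>
          (2 * a j t + b j t) * ((2 * a i t + b i t) * Real.sign (q j t - q i t) *
            Real.exp (-|q j t - q i t|))) fun j i => by
              rw [← neg_sub (q i t) (q j t), Real.sign_neg, abs_neg]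
              ring]
        refine Finset.sum_congr rfl fun j _ => ?_
        rw [← Finset.mul_sum]
        simp only [hF]
        ring
      rw [← h0]
      exact HasDerivAt.fun_sum fun j hj => (ha j (Finset.mem_range.1 hj) t).add
        (hb j (Finset.mem_range.1 hj) t)
    have hconst := is_const_of_deriv_eq_zero (fun t => (hd t).differentiableAt)
      (fun t => (hd t).deriv) t 0
    have hsum : ∀ t, ∑ j ∈ Finset.range N, ((k j) ^ 2 * (b j t) ^ 2 + b j t) =
        ∑ j ∈ Finset.range N, (a j t + b j t) := fun t =>
      Finset.sum_congr rfl fun j hj => by rw [hcasimir t j (Finset.mem_range.1 hj)]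
    rw [hsum, hsum]
    exact congrArg (2 * ·) hconst
  refine ⟨hpos, fun t j l hjl hl => ?_, hquadric,
    ∑ j ∈ Finset.range N, ((k j) ^ 2 * (b j 0) ^ 2 + b j 0), fun t j hj => ?_⟩
  · refine sub_pos.1 (pos_of_abs_deriv_le_mul_abs (y := fun t => q l t - q j t) hS
      (fun t => (hq l hl t).sub (hq j (hjl.trans hl) t)) (fun t => ?_)
      (sub_pos.2 (horder j l hjl hl)) t)
    rw [← Finset.sum_sub_distrib, Finset.sum_mul]
    refine (Finset.abs_sum_le_sum_abs _ _).trans (Finset.sum_le_sum fun i _ => ?_)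
    rw [← mul_sub, abs_mul]
    refine mul_le_mul_of_nonneg_left ((abs_exp_neg_abs_sub_le _ _).trans_eq ?_) (abs_nonneg _)
    congr 1
    ring
  · have h := hquadric t
    have hj' := Finset.single_le_sum (s := Finset.range N)
      (f := fun j => (k j) ^ 2 * (b j t) ^ 2 + b j t)
      (fun i hi => add_nonneg (by positivity) (hpos t i (Finset.mem_range.1 hi)).le)
      (Finset.mem_range.2 hj)
    rw [abs_of_pos (hpos t j hj)]
    have : 0 ≤ (k j) ^ 2 * (b j t) ^ 2 := by positivity
    linarith
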